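/- For any finite metric space X and any finite set of partial isometries φ₁,…,φₙ of X, there exists a finite metric space Y containing X isometrically such that each φᵢ extends to a (bijective) isometry of Y. -/

import Mathlib

open scoped NNReal
universe u

namespace SoleckiAux

lemma iteCongr {α : Type u} {c d : Prop} {_ : Decidable c} {_ : Decidable d} {x y z t : α}
    (h : c ↔ d) (h1 : x = z) (h2 : y = t) : ite c x y = ite d z t := by
  by_cases hd : d
  · rw [if_pos hd, if_pos (h.2 hd), h1]
  · rw [if_neg hd, if_neg (mt h.1 hd), h2]

lemma decTrue {c : Prop} {_ : Decidable c} (h : c) : decide c = true := by simp [h]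

lemma decFalse {c : Prop} {_ : Decidable c} (h : ¬ c) : decide c = false := by simp [h]

lemma decCongr {c d : Prop} {_ : Decidable c} {_ : Decidable d} (h : c ↔ d) :
    decide c = decide d := by
  rw [decide_eq_decide, h]

/-- Total weight of the first `n` steps of the walk `v`. -/
def walkSum {B : Type u} (w : B → B → ℝ≥0) (v : ℕ → B) (n : ℕ) : ℝ≥0 :=
  ∑ i ∈ Finset.range n, w (v i) (v (i + 1))

/-- A finite weighted graph (weight `D` means: no edge) into which `X` embeds, with
automorphisms extending the partial isometries, without non-metric cycles having at most
`k + 1` edges. -/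
structure Sys (X : Type u) [MetricSpace X] (n : ℕ) (A : Fin n → Set X) (f : Fin n → X → X)
    (D ε : ℝ≥0) (k : ℕ) where
  B : Type u
  fin : Finite B
  w : B → B → ℝ≥0
  symm : ∀ x y, w x y = w y x
  self : ∀ x, w x x = 0
  le : ∀ x y, w x y ≤ D
  ge : ∀ x y, x ≠ y → ε ≤ w x y
  ι : X → B
  hι : ∀ a b, w (ι a) (ι b) = nndist a b
  ψ : Fin n → Equiv.Perm B
  hψ : ∀ i x y, w (ψ i x) (ψ i y) = w x y
  ext : ∀ i, ∀ a ∈ A i, ψ i (ι a) = ι (f i a)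
  P : ∀ j ≤ k, ∀ v : ℕ → B, w (v 0) (v j) < D → w (v 0) (v j) ≤ walkSum w v j

section Step
variable {B : Type u} (w : B → B → ℝ≥0) (D : ℝ≥0) (m : ℕ)

/-- Extension of a tuple to a walk. -/
def tw {B : Type u} {m : ℕ} (M : Fin (m + 1) → B) (i : ℕ) : B := M (Fin.ofNat (m + 1) i)

/-- Non-metric cycles. -/
def Bad {B : Type u} (w : B → B → ℝ≥0) (D : ℝ≥0) {m : ℕ} (M : Fin (m + 1) → B) : Prop :=
  w (tw M 0) (tw M m) < D ∧ walkSum w (tw M) m < w (tw M 0) (tw M m)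

/-- `x, y` are the ends of the long edge of `M`. -/
def Long {B : Type u} {m : ℕ} (M : Fin (m + 1) → B) (x y : B) : Prop :=
  (x = tw M 0 ∧ y = tw M m) ∨ (y = tw M 0 ∧ x = tw M m)

open Classical in
/-- Compatibility of two vertices of the unfolding. -/
def Comp {B : Type u} (w : B → B → ℝ≥0) (D : ℝ≥0) {m : ℕ}
    (p q : B × ((Fin (m + 1) → B) → Bool)) : Prop :=
  (p.1 = q.1 → p.2 = q.2) ∧ ∀ M, Bad w D M → p.1 ∈ Set.range M → q.1 ∈ Set.range M →
    (p.2 M ^^ q.2 M) = decide (Long M p.1 q.1)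

lemma Long.symm {B : Type u} {m : ℕ} {M : Fin (m + 1) → B} {x y : B} (h : Long M x y) :
    Long M y x := Or.symm h

lemma long_comm {B : Type u} {m : ℕ} {M : Fin (m + 1) → B} {x y : B} :
    Long M x y ↔ Long M y x := ⟨Long.symm, Long.symm⟩

lemma tw_mem {B : Type u} {m : ℕ} (M : Fin (m + 1) → B) (i : ℕ) : tw M i ∈ Set.range M := ⟨_, rfl⟩

lemma mem_range {B : Type u} {m : ℕ} {M : Fin (m + 1) → B} {x : B} (h : x ∈ Set.range M) :
    ∃ j ≤ m, x = tw M j := by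
  obtain ⟨i, rfl⟩ := h
  exact ⟨i, by omega, by simp [tw]⟩

lemma tw_of {B : Type u} {m : ℕ} (v : ℕ → B) (i : ℕ) (h : i ≤ m) :
    tw (fun i : Fin (m + 1) => v i) i = v i := by
  simp [tw, Nat.mod_eq_of_lt (Nat.lt_succ_of_le h)]

lemma tw_comp {B : Type u} {m : ℕ} (M : Fin (m + 1) → B) (g : B → B) (i : ℕ) :
    tw (g ∘ M) i = g (tw M i) := rfl

lemma bad_comp {B : Type u} {w : B → B → ℝ≥0} {D : ℝ≥0} {m : ℕ} {M : Fin (m + 1) → B}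
    {g : B → B} (hg : ∀ x y, w (g x) (g y) = w x y) : Bad w D (g ∘ M) ↔ Bad w D M := by
  simp [Bad, walkSum, tw_comp, hg]

lemma long_map {B : Type u} {m : ℕ} {M : Fin (m + 1) → B}
    {g : Equiv.Perm B} {x y : B} : Long (g ∘ M) (g x) (g y) ↔ Long M x y := by
  simp [Long, tw_comp]

lemma range_map {B : Type u} {m : ℕ} {M : Fin (m + 1) → B}
    {g : Equiv.Perm B} {x : B} : g x ∈ Set.range (g ∘ M) ↔ x ∈ Set.range M := by
  simp

lemma comp_symm {B : Type u} {w : B → B → ℝ≥0} {D : ℝ≥0} {m : ℕ}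
    {p q : B × ((Fin (m + 1) → B) → Bool)} (h : Comp w D p q) : Comp w D q p := by
  refine ⟨fun e => (h.1 e.symm).symm, fun M hM hq hp => ?_⟩
  rw [Bool.xor_comm, h.2 M hM hp hq]
  simp [long_comm]

lemma Bad.ne {B : Type u} {w : B → B → ℝ≥0} {D : ℝ≥0} {m : ℕ} {M : Fin (m + 1) → B}
    (h : Bad w D M) (h0 : ∀ x, w x x = 0) : tw M 0 ≠ tw M m := by
  intro e
  have := h.2
  rw [e, h0] at this
  exact not_lt_bot this

lemma comp_self {B : Type u} {w : B → B → ℝ≥0} {D : ℝ≥0} {m : ℕ} (h0 : ∀ x, w x x = 0)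
    (p : B × ((Fin (m + 1) → B) → Bool)) : Comp w D p p := by
  refine ⟨fun _ => rfl, fun M hM hq hp => ?_⟩
  have : ¬ Long M p.1 p.1 := by
    rintro (⟨h1, h2⟩ | ⟨h1, h2⟩) <;> exact hM.ne h0 (h1.symm.trans h2)
  simp [this]

/-- Consecutive vertices of a bad cycle are not the ends of the long edge. -/
lemma Bad.not_long {B : Type u} {w : B → B → ℝ≥0} {D : ℝ≥0} {m : ℕ} {M : Fin (m + 1) → B}
    (h : Bad w D M) (hs : ∀ x y, w x y = w y x) {i : ℕ} (hi : i < m) :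
    ¬ Long M (tw M i) (tw M (i + 1)) := by
  have h1 : w (tw M i) (tw M (i + 1)) ≤ walkSum w (tw M) m :=
    Finset.single_le_sum (f := fun i => w (tw M i) (tw M (i + 1)))
      (fun _ _ => zero_le) (Finset.mem_range.2 hi)
  have h2 := lt_of_le_of_lt h1 h.2
  rintro (⟨e1, e2⟩ | ⟨e1, e2⟩)
  · rw [e1, e2] at h2; exact lt_irrefl _ h2
  · rw [e1, e2, hs] at h2; exact lt_irrefl _ h2

open Classical in
/-- Weights of the unfolding. -/
noncomputable def w' {B : Type u} (w : B → B → ℝ≥0) (D : ℝ≥0) {m : ℕ}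
    (p q : B × ((Fin (m + 1) → B) → Bool)) : ℝ≥0 :=
  if Comp w D p q then w p.1 q.1 else D

lemma w'_lt {B : Type u} {w : B → B → ℝ≥0} {D : ℝ≥0} {m : ℕ}
    {p q : B × ((Fin (m + 1) → B) → Bool)} (h : w' w D p q < D) :
    Comp w D p q ∧ w' w D p q = w p.1 q.1 := by
  unfold w' at *
  split_ifs at * with h1
  · exact ⟨h1, rfl⟩
  · exact absurd h (lt_irrefl _)

lemma le_w' {B : Type u} {w : B → B → ℝ≥0} {D : ℝ≥0} {m : ℕ} (hD : ∀ x y, w x y ≤ D)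
    (p q : B × ((Fin (m + 1) → B) → Bool)) : w p.1 q.1 ≤ w' w D p q := by
  unfold w'
  split_ifs
  · exact le_rfl
  · exact hD _ _

lemma no_bad {B : Type u} {w : B → B → ℝ≥0} {D : ℝ≥0} {m : ℕ} (hD : ∀ x y, w x y ≤ D)
    (hs : ∀ x y, w x y = w y x)
    (v : ℕ → B × ((Fin (m + 1) → B) → Bool)) (h : w' w D (v 0) (v m) < D) :
    w' w D (v 0) (v m) ≤ walkSum (w' w D) v m := by
  by_contra! hlt
  obtain ⟨hc, he⟩ := w'_lt h
  set M : Fin (m + 1) → B := fun i => (v i).1 with hMdef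
  have hM : ∀ i ≤ m, tw M i = (v i).1 := fun i hi => tw_of (fun i => (v i).1) i hi
  have hstep : ∀ i < m, w' w D (v i) (v (i + 1)) < D := fun i hi =>
    lt_of_le_of_lt (Finset.single_le_sum (f := fun i => w' w D (v i) (v (i + 1)))
      (fun _ _ => zero_le) (Finset.mem_range.2 hi)) (hlt.trans h)
  have hsum : walkSum (w' w D) v m = walkSum w (tw M) m := by
    refine Finset.sum_congr rfl fun i hi => ?_
    have hi := Finset.mem_range.1 hi
    rw [(w'_lt (hstep i hi)).2, hM i hi.le, hM (i + 1) hi]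
  have hbad : Bad w D M := by
    unfold Bad
    rw [hM 0 (Nat.zero_le _), hM m le_rfl, ← hsum, ← he]
    exact ⟨h, hlt⟩
  have hr : ∀ i ≤ m, (v i).1 ∈ Set.range M := fun i hi => hM i hi ▸ tw_mem M i
  have hconst : ∀ i ≤ m, (v i).2 M = (v 0).2 M := by
    intro i
    induction i with
    | zero => intro _; rfl
    | succ i ih =>
      intro hi
      have h1 := (w'_lt (hstep i hi)).1.2 M hbad (hr i (by omega)) (hr (i + 1) hi)
      have h2 := hbad.not_long hs (i := i) hi
      rw [hM i (by omega), hM (i + 1) hi] at h2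
      rw [← ih (by omega)]
      rw [decFalse h2] at h1
      revert h1
      cases (v i).2 M <;> cases (v (i + 1)).2 M <;> simp
  have h1 := hc.2 M hbad (hr 0 (Nat.zero_le _)) (hr m le_rfl)
  have h2 : Long M (v 0).1 (v m).1 := Or.inl ⟨(hM 0 (Nat.zero_le _)).symm, (hM m le_rfl).symm⟩
  rw [hconst m le_rfl] at h1
  simp [h2] at h1

end Step

open Classical in
/-- Valuation of the points of `X`. -/
noncomputable def val {X B : Type u} (w : B → B → ℝ≥0) (D : ℝ≥0) {m : ℕ} (ι : X → B) (a : X)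
    (M : Fin (m + 1) → B) : Bool :=
  decide (Bad w D M ∧ ι a = tw M 0 ∧ ∃ b, ι b = tw M m)

lemma comp_val {X : Type u} [MetricSpace X] {n : ℕ} {A : Fin n → Set X} {f : Fin n → X → X}
    {D ε : ℝ≥0} {k : ℕ} (S : Sys X n A f D ε k) (hD : ∀ a b : X, nndist a b < D) (a b : X) :
    Comp S.w D (m := k + 1) (S.ι a, val S.w D S.ι a) (S.ι b, val S.w D S.ι b) := by
  refine ⟨fun h => ?_, fun M hM ha hb => ?_⟩
  · funext M
    simp only at h
    simp [val, h]
  simp only at ha hb ⊢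
  have key : ∀ x y z, S.ι x = tw M 0 → S.ι y = tw M (k + 1) → S.ι z ∈ Set.range M →
      S.ι z = tw M 0 ∨ S.ι z = tw M (k + 1) := by
    intro x y z hx hy hz
    obtain ⟨j, hj, hz⟩ := mem_range hz
    by_cases h0 : j = 0
    · subst h0; exact Or.inl hz
    by_cases h1 : j = k + 1
    · subst h1; exact Or.inr hz
    exfalso
    have p1 := S.P j (by omega) (tw M) (by rw [← hx, ← hz, S.hι]; exact hD _ _)
    have p2 := S.P (k + 1 - j) (by omega) (fun i => tw M (j + i))
      (by
        have : j + (k + 1 - j) = k + 1 := by omega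
        simp only [add_zero, this]
        rw [← hy, ← hz, S.hι]; exact hD _ _)
    have e : j + (k + 1 - j) = k + 1 := by omega
    have p3 : walkSum S.w (tw M) j + walkSum S.w (fun i => tw M (j + i)) (k + 1 - j)
        = walkSum S.w (tw M) (k + 1) := by
      have := (Finset.sum_range_add (fun i => S.w (tw M i) (tw M (i + 1))) j (k + 1 - j)).symm
      rw [e] at this
      exact this
    simp only [add_zero, e] at p2
    have p4 := hM.2
    rw [← p3] at p4
    rw [← hx, ← hz, S.hι] at p1
    rw [← hy, ← hz, S.hι] at p2
    rw [← hx, ← hy, S.hι] at p4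
    exact absurd (p4.trans_le (nndist_triangle x z y)) (not_lt.2 (add_le_add p1 p2))
  have hne := hM.ne S.self
  by_cases hl : Long M (S.ι a) (S.ι b)
  · rcases hl with ⟨h1, h2⟩ | ⟨h1, h2⟩
    · have : val S.w D S.ι a M = true := by simp only [val, decide_eq_true_eq]; exact ⟨hM, h1, b, h2⟩
      have h' : val S.w D S.ι b M = false := by
        simp only [val, decide_eq_false_iff_not]; rintro ⟨_, h, _⟩; exact hne (h.symm.trans h2)
      simp [this, h', Long, h1, h2]
    · have : val S.w D S.ι b M = true := by simp only [val, decide_eq_true_eq]; exact ⟨hM, h1, a, h2⟩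
      have h' : val S.w D S.ι a M = false := by
        simp only [val, decide_eq_false_iff_not]; rintro ⟨_, h, _⟩; exact hne (h.symm.trans h2)
      simp [this, h', Long, h1, h2]
  · have aux : ∀ a b, S.ι b ∈ Set.range M → ¬ Long M (S.ι a) (S.ι b) →
        val S.w D S.ι a M = true → val S.w D S.ι b M = true := by
      intro a b hb hl h
      simp only [val, decide_eq_true_eq] at h ⊢
      obtain ⟨_, h1, c, h2⟩ := h
      rcases key a c b h1 h2 hb with h3 | h3
      · exact ⟨hM, h3, c, h2⟩
      · exact absurd (Or.inl ⟨h1, h3⟩) hl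
    have i1 := aux a b hb hl
    have i2 := aux b a ha (fun h => hl h.symm)
    have : val S.w D S.ι a M = val S.w D S.ι b M := Bool.eq_iff_iff.2 ⟨i1, i2⟩
    simp [this, hl]

lemma val_of_not {X B : Type u} {w : B → B → ℝ≥0} {D : ℝ≥0} {m : ℕ} {ι : X → B} {a : X}
    {M : Fin (m + 1) → B} (h : ι a ∉ Set.range M) : val w D ι a M = false := by
  simp only [val, decide_eq_false_iff_not]
  rintro ⟨_, h1, _⟩
  exact h (h1 ▸ tw_mem M 0)

lemma exists_flip {X : Type u} [MetricSpace X] {n : ℕ} {A : Fin n → Set X} {f : Fin n → X → X}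
    {D ε : ℝ≥0} {k : ℕ} (S : Sys X n A f D ε k) (hD : ∀ a b : X, nndist a b < D)
    (i : Fin n) (M : Fin (k + 1 + 1) → S.B) :
    ∃ c : Bool, ∀ a ∈ A i, S.ι a ∈ Set.range M →
      val S.w D S.ι (f i a) (S.ψ i ∘ M) = (val S.w D S.ι a M ^^ c) := by
  by_cases hM : Bad S.w D M
  swap
  · have hM' := mt (bad_comp (S.hψ i)).1 hM
    exact ⟨false, fun a _ _ => by simp [val, hM, hM']⟩
  by_cases h : ∃ a ∈ A i, S.ι a ∈ Set.range M
  swap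
  · exact ⟨false, fun a h1 h2 => absurd ⟨a, h1, h2⟩ h⟩
  obtain ⟨a, ha, haM⟩ := h
  refine ⟨(val S.w D S.ι a M ^^ val S.w D S.ι (f i a) (S.ψ i ∘ M)), fun b hb hbM => ?_⟩
  have h1 := (comp_val S hD a b).2 M hM haM hbM
  have h2 := (comp_val S hD (f i a) (f i b)).2 (S.ψ i ∘ M) ((bad_comp (S.hψ i)).2 hM)
    (by simp only; rw [← S.ext i a ha]; exact range_map.2 haM)
    (by simp only; rw [← S.ext i b hb]; exact range_map.2 hbM)
  simp only at h1 h2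
  rw [← S.ext i a ha, ← S.ext i b hb] at h2
  rw [decCongr long_map, ← h1] at h2
  revert h2
  generalize val S.w D S.ι a M = p
  generalize val S.w D S.ι b M = q
  generalize val S.w D S.ι (f i a) (S.ψ i ∘ M) = r
  generalize val S.w D S.ι (f i b) (S.ψ i ∘ M) = s
  revert p q r s
  decide

open Classical in
/-- Lift of an automorphism. -/
noncomputable def lift {B : Type u} {m : ℕ} (g : Equiv.Perm B)
    (c : (Fin (m + 1) → B) → Bool) :
    Equiv.Perm (B × ((Fin (m + 1) → B) → Bool)) where
  toFun p := (g p.1, fun N => p.2 (g.symm ∘ N) ^^ (decide (p.1 ∈ Set.range (g.symm ∘ N)) && c (g.symm ∘ N)))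
  invFun p := (g.symm p.1, fun M => p.2 (g ∘ M) ^^ (decide (g.symm p.1 ∈ Set.range M) && c M))
  left_inv p := by
    ext M
    · simp
    · have : g.symm ∘ g ∘ M = M := by ext; simp
      simp only [this, Equiv.symm_apply_apply]
      simp
  right_inv p := by
    ext M
    · simp
    · have : g ∘ g.symm ∘ M = M := by ext; simp
      simp only [this]
      simp

lemma lift_apply {B : Type u} {m : ℕ} (g : Equiv.Perm B)
    (c : (Fin (m + 1) → B) → Bool) (p : B × ((Fin (m + 1) → B) → Bool)) (M : Fin (m + 1) → B) :
    (lift g c p).2 (g ∘ M) = open Classical in (p.2 M ^^ (decide (p.1 ∈ Set.range M) && c M)) := by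
  have : g.symm ∘ g ∘ M = M := by ext; simp
  simp only [lift, Equiv.coe_fn_mk]
  rw [this]

lemma comp_lift {B : Type u} {w : B → B → ℝ≥0} {D : ℝ≥0} {m : ℕ} {g : Equiv.Perm B}
    (hg : ∀ x y, w (g x) (g y) = w x y)
    (c : (Fin (m + 1) → B) → Bool) (p q : B × ((Fin (m + 1) → B) → Bool)) :
    Comp w D (lift g c p) (lift g c q) ↔ Comp w D p q := by
  have hfst : ∀ p, (lift g c p).1 = g p.1 := fun _ => rfl
  have e1 : ((lift g c p).1 = (lift g c q).1 → (lift g c p).2 = (lift g c q).2) ↔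
      (p.1 = q.1 → p.2 = q.2) := by
    have : ∀ p q : B × ((Fin (m + 1) → B) → Bool), (p.1 = q.1 → p.2 = q.2) ↔ (p.1 = q.1 → p = q) := by
      intro p q
      exact ⟨fun h e => Prod.ext e (h e), fun h e => by rw [h e]⟩
    rw [this, this]
    simp [hfst]
  unfold Comp
  rw [e1]
  refine and_congr_right fun _ => ?_
  have hsurj : Function.Surjective (fun M : Fin (m + 1) → B => g ∘ M) := fun N =>
    ⟨g.symm ∘ N, by ext; simp⟩
  rw [hsurj.forall]
  refine forall_congr' fun M => ?_
  simp only [bad_comp hg, hfst, range_map, lift_apply]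
  classical
  refine forall_congr' fun _ => forall_congr' fun h1 => forall_congr' fun h2 => ?_
  rw [decTrue h1, decTrue h2, hfst, hfst, @decCongr _ (Long M p.1 q.1) _ (Classical.propDecidable _) long_map]
  simp only [Bool.true_and]
  cases p.2 M <;> cases q.2 M <;> cases c M <;> simp

/-- The unfolding step. -/
noncomputable def step {X : Type u} [MetricSpace X] {n : ℕ} {A : Fin n → Set X} {f : Fin n → X → X}
    {D ε : ℝ≥0} {k : ℕ} (S : Sys X n A f D ε k) (hD : ∀ a b : X, nndist a b < D) (hε : ε ≤ D) :
    Sys X n A f D ε (k + 1) where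
  B := S.B × ((Fin (k + 1 + 1) → S.B) → Bool)
  fin := by have := S.fin; infer_instance
  w := w' S.w D
  symm p q := by
    have : Comp S.w D p q ↔ Comp S.w D q p := ⟨comp_symm, comp_symm⟩
    exact iteCongr this (S.symm p.1 q.1) rfl
  self p := by simp [w', comp_self S.self, S.self]
  le p q := by
    unfold w'
    split_ifs
    · exact S.le _ _
    · exact le_rfl
  ge p q hpq := by
    unfold w'
    split_ifs with h
    · exact S.ge _ _ fun e => hpq (Prod.ext e (h.1 e))
    · exact hε
  ι a := (S.ι a, val S.w D S.ι a)
  hι a b := by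
    unfold w'
    rw [if_pos (comp_val S hD a b)]
    exact S.hι a b
  ψ i := lift (S.ψ i) (fun M => (exists_flip S hD i M).choose)
  hψ i p q := by
    exact iteCongr (comp_lift (S.hψ i) _ p q) (S.hψ i p.1 q.1) rfl
  ext i a ha := by
    refine Prod.ext (S.ext i a ha) (funext fun N => ?_)
    obtain ⟨M, rfl⟩ : ∃ M, N = S.ψ i ∘ M := ⟨(S.ψ i).symm ∘ N, by ext; simp⟩
    rw [lift_apply]
    by_cases h : S.ι a ∈ Set.range M
    · have := (exists_flip S hD i M).choose_spec a ha h
      simp only [this, h, decide_true, Bool.true_and]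
    · have h' : S.ι (f i a) ∉ Set.range (S.ψ i ∘ M) := by
        rw [← S.ext i a ha, range_map]; exact h
      simp only [val_of_not h, val_of_not h', h, decide_false, Bool.false_and, Bool.xor_false]
  P j hj v h := by
    rcases Nat.lt_or_ge k j with hk | hk
    · obtain rfl : j = k + 1 := by omega
      exact no_bad S.le S.symm v h
    · have he := (w'_lt h).2
      rw [he] at h ⊢
      refine (S.P j hk (fun i => (v i).1) h).trans ?_
      exact Finset.sum_le_sum fun i _ => le_w' S.le _ _

section Base
variable {X : Type u} [MetricSpace X]

open Classical in
/-- Code of a distance. -/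
noncomputable def code (x y : X) : X × X → ZMod 3 :=
  fun p => if dist p.1 p.2 = dist x y then 1 else 0

lemma code_eq_iff {x y x' y' : X} : code x y = code x' y' ↔ dist x y = dist x' y' := by
  constructor
  · intro h
    have := congrFun h (x, y)
    by_contra hne
    simp only [code] at this
    rw [if_pos trivial, if_neg hne] at this
    exact one_ne_zero this
  · intro h
    funext p
    exact iteCongr (by rw [h]) rfl rfl

lemma three_aux {X : Type u} (u : X × X → ZMod 3) : -u + -u = u := by
  funext p
  have : ∀ z : ZMod 3, -z + -z = z := by decide
  exact this (u p)

open Classical in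
/-- Distance from its code. -/
noncomputable def decode (D : ℝ≥0) (u : X × X → ZMod 3) : ℝ≥0 :=
  if h : ∃ p : X × X, p.1 ≠ p.2 ∧ u = code p.1 p.2 then nndist h.choose.1 h.choose.2 else D

lemma decode_code (D : ℝ≥0) {x y : X} (h : x ≠ y) : decode D (code x y) = nndist x y := by
  have h' : ∃ p : X × X, p.1 ≠ p.2 ∧ code x y = code p.1 p.2 := ⟨(x, y), h, rfl⟩
  rw [decode, dif_pos h']
  have := code_eq_iff.1 h'.choose_spec.2
  exact NNReal.eq (by simpa using this.symm)

lemma le_decode {D ε : ℝ≥0} (hε : ε ≤ D) (h : ∀ a b : X, a ≠ b → ε ≤ nndist a b)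
    (u : X × X → ZMod 3) : ε ≤ decode D u := by
  unfold decode
  split_ifs with h'
  · exact h _ _ h'.choose_spec.1
  · exact hε

lemma decode_le {D : ℝ≥0} (h : ∀ a b : X, nndist a b < D)
    (u : X × X → ZMod 3) : decode D u ≤ D := by
  unfold decode
  split_ifs with h'
  · exact (h _ _).le
  · exact le_rfl

open Classical in
/-- Weights of the base graph. -/
noncomputable def w0 (D : ℝ≥0) (p q : X × (X → X × X → ZMod 3)) : ℝ≥0 :=
  if p.1 = q.1 then (if p.2 = q.2 then 0 else D) else decode D (p.2 q.1 + q.2 p.1)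

open Classical in
/-- Correction term of the lift of a permutation. -/
noncomputable def corr (s : Set X) (σ : Equiv.Perm X) (x y : X) : X × X → ZMod 3 :=
  if x ∈ s then (if y ∈ s then 0 else code x y - code (σ x) (σ y))
  else (if y ∈ s then -(code y x - code (σ y) (σ x)) else 0)

lemma corr_anti (s : Set X) (σ : Equiv.Perm X) (x y : X) : corr s σ x y + corr s σ y x = 0 := by
  unfold corr
  split_ifs <;> simp

/-- Lift of a permutation to the base graph. -/
noncomputable def lift0 (s : Set X) (σ : Equiv.Perm X) :
    Equiv.Perm (X × (X → X × X → ZMod 3)) where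
  toFun p := (σ p.1, fun y => p.2 (σ.symm y) + corr s σ p.1 (σ.symm y))
  invFun p := (σ.symm p.1, fun y => p.2 (σ y) - corr s σ (σ.symm p.1) y)
  left_inv p := by ext <;> simp
  right_inv p := by ext <;> simp

lemma w0_lift0 (D : ℝ≥0) (s : Set X) (σ : Equiv.Perm X) (p q : X × (X → X × X → ZMod 3)) :
    w0 D (lift0 s σ p) (lift0 s σ q) = w0 D p q := by
  have hfst : ∀ p, (lift0 s σ p).1 = σ p.1 := fun _ => rfl
  have hsnd : ∀ p y, (lift0 s σ p).2 (σ y) = p.2 y + corr s σ p.1 y := fun p y => by simp [lift0]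
  unfold w0
  by_cases h : p.1 = q.1
  · have e : (lift0 s σ p).2 = (lift0 s σ q).2 ↔ p.2 = q.2 := by
      constructor
      · intro h2
        have : lift0 s σ p = lift0 s σ q := Prod.ext (by rw [hfst, hfst, h]) h2
        rw [(lift0 s σ).injective this]
      · intro h2
        rw [Prod.ext h h2]
    rw [if_pos (by rw [hfst, hfst, h]), if_pos h]
    exact iteCongr e rfl rfl
  · have e : p.2 q.1 + corr s σ p.1 q.1 + (q.2 p.1 + corr s σ q.1 p.1) = p.2 q.1 + q.2 p.1 := by
      have := corr_anti s σ p.1 q.1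
      rw [add_add_add_comm, this, add_zero]
    rw [if_neg (by rw [hfst, hfst]; exact fun h' => h (σ.injective h')), if_neg h]
    rw [hfst, hfst, hsnd, hsnd, e]

lemma exists_perm [Fintype X] (s : Set X) (g : X → X)
    (hg : ∀ a ∈ s, ∀ b ∈ s, dist (g a) (g b) = dist a b) :
    ∃ σ : Equiv.Perm X, ∀ a ∈ s, σ a = g a := by
  classical
  have hinj : Set.InjOn g s := fun a ha b hb h => by
    have := hg a ha b hb
    rw [h, dist_self] at this
    exact dist_eq_zero.1 this.symm
  obtain ⟨e, he⟩ := Set.MapsTo.exists_equiv_extend_of_card_eq (t := Finset.univ) (by simp)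
    (s := s) (f := g) (fun _ _ => by simp) hinj
  exact ⟨e.trans (Equiv.subtypeUnivEquiv (by simp)), fun a ha => he a ha⟩

/-- The base graph. -/
noncomputable def base [Fintype X] {n : ℕ} {A : Fin n → Set X} {f : Fin n → X → X}
    (hf : ∀ i, ∀ a ∈ A i, ∀ b ∈ A i, dist (f i a) (f i b) = dist a b)
    {D ε : ℝ≥0} (hD : ∀ a b : X, nndist a b < D) (hε : ε ≤ D)
    (hX : ∀ a b : X, a ≠ b → ε ≤ nndist a b) :
    Sys X n A f D ε 0 where
  B := X × (X → X × X → ZMod 3)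
  fin := inferInstance
  w := w0 D
  symm p q := by
    exact iteCongr eq_comm (iteCongr eq_comm rfl rfl) (by rw [add_comm])
  self p := by simp [w0]
  le p q := by
    unfold w0
    split_ifs
    · exact zero_le
    · exact le_rfl
    · exact decode_le hD _
  ge p q hpq := by
    unfold w0
    split_ifs with h1 h2
    · exact absurd (Prod.ext h1 h2) hpq
    · exact hε
    · exact le_decode hε hX _
  ι x := (x, fun y => -code x y)
  hι a b := by
    unfold w0
    by_cases h : a = b
    · subst h; simp
    · have : code b a = code a b := code_eq_iff.2 (dist_comm _ _)
      simp only [h, if_false, this, three_aux, decode_code D h]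
  ψ i := lift0 (A i) (exists_perm (A i) (f i) (hf i)).choose
  hψ i p q := w0_lift0 _ _ _ _ _
  ext i a ha := by
    have hσ := (exists_perm (A i) (f i) (hf i)).choose_spec
    generalize (exists_perm (A i) (f i) (hf i)).choose = σ at hσ
    refine Prod.ext (hσ a ha) (funext fun z => ?_)
    obtain ⟨y, rfl⟩ := σ.surjective z
    simp only [lift0, Equiv.coe_fn_mk, Equiv.symm_apply_apply, corr, ha, if_true]
    rw [← hσ a ha]
    by_cases hy : y ∈ A i
    · have : code (σ a) (σ y) = code a y := code_eq_iff.2 (by rw [hσ a ha, hσ y hy, hf i a ha y hy])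
      simp [hy, this]
    · rw [if_neg (by rwa [Equiv.symm_apply_apply])]
      abel
  P j hj v h := by
    obtain rfl : j = 0 := by omega
    simp [w0]

end Base

lemma shrink {B : Type u} {w : B → B → ℝ≥0} {ε : ℝ≥0} (h0 : ∀ x, w x x = 0)
    (hw : ∀ x y, x ≠ y → ε ≤ w x y) (l : List B) (x y : B) :
    ∃ (n : ℕ) (v : ℕ → B), v 0 = x ∧ v n = y ∧ n * ε ≤ walkSum w v n ∧
      walkSum w v n = (List.zipWith w (x :: l) (l ++ [y])).sum := by
  have cons : ∀ (x z y : B) (s : ℝ≥0), (∃ (n : ℕ) (v : ℕ → B), v 0 = z ∧ v n = y ∧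
      n * ε ≤ walkSum w v n ∧ walkSum w v n = s) →
      ∃ (n : ℕ) (v : ℕ → B), v 0 = x ∧ v n = y ∧ n * ε ≤ walkSum w v n ∧
        walkSum w v n = w x z + s := by
    rintro x z y s ⟨n, v, h1, h2, h3, h4⟩
    by_cases h : x = z
    · subst h
      exact ⟨n, v, h1, h2, h3, by rw [h0, zero_add, h4]⟩
    · let v' : ℕ → B := fun i => Nat.casesOn i x v
      have e : walkSum w v' (n + 1) = w x z + walkSum w v n := by
        unfold walkSum
        rw [Finset.sum_range_succ', add_comm]
        subst h1
        rfl
      refine ⟨n + 1, v', rfl, h2, ?_, by rw [e, h4]⟩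
      rw [e]
      push_cast
      rw [add_mul, one_mul, add_comm]
      exact add_le_add (hw _ _ h) h3
  induction l generalizing x with
  | nil => exact cons x y y 0 ⟨0, fun _ => y, rfl, rfl, by simp, by simp [walkSum]⟩
  | cons z l ih => exact cons x z y _ (ih z)

/-- The path metric. -/
noncomputable def pathMetric {B : Type u} {w : B → B → ℝ≥0} {ε : ℝ≥0} (h0 : ∀ x, w x x = 0)
    (hs : ∀ x y, w x y = w y x) (hε : 0 < ε)
    (hw : ∀ x y, x ≠ y → ε ≤ w x y) : MetricSpace B :=
  { PseudoMetricSpace.ofPreNNDist w h0 hs with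
    eq_of_dist_eq_zero := by
      intro x y h
      by_contra hne
      have h1 : ε ≤ ⨅ l : List B, ((x::l).zipWith w (l ++ [y])).sum := by
        refine le_ciInf fun l => ?_
        obtain ⟨n, v, h1, h2, h3, h4⟩ := shrink h0 hw l x y
        rw [← h4]
        refine le_trans ?_ h3
        have : 1 ≤ n := by
          rcases Nat.eq_zero_or_pos n with rfl | h
          · exact absurd (h1.symm.trans h2) hne
          · exact h
        exact le_mul_of_one_le_left zero_le (by exact_mod_cast this)
      have h2 : (⨅ l : List B, ((x::l).zipWith w (l ++ [y])).sum) = 0 := NNReal.coe_eq_zero.1 h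
      rw [h2] at h1
      exact absurd hε (not_lt.2 h1) }

lemma iInf_map_le {B : Type u} {w : B → B → ℝ≥0} {g : B → B}
    (hg : ∀ x y, w (g x) (g y) = w x y) (x y : B) :
    (⨅ l : List B, ((g x::l).zipWith w (l ++ [g y])).sum) ≤
      ⨅ l : List B, ((x::l).zipWith w (l ++ [y])).sum := by
  refine le_ciInf fun l => (ciInf_le (OrderBot.bddBelow _) (l.map g)).trans_eq ?_
  have e1 : g x :: l.map g = (x :: l).map g := rfl
  have e2 : l.map g ++ [g y] = (l ++ [y]).map g := by simp
  rw [e1, e2, List.zipWith_map]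
  simp only [hg]

theorem core {X : Type u} [MetricSpace X] [Fintype X]
    (n : ℕ) (A : Fin n → Set X) (f : Fin n → X → X)
    (hf : ∀ i, ∀ a ∈ A i, ∀ b ∈ A i, dist (f i a) (f i b) = dist a b) :
    ∃ (Y : Type u) (_ : MetricSpace Y) (_ : Finite Y) (ι : X → Y),
      Isometry ι ∧ ∀ i : Fin n, ∃ ψ : Y ≃ᵢ Y, ∀ a ∈ A i, ψ (ι a) = ι (f i a) := by
  obtain ⟨D, hD⟩ : ∃ D : ℝ≥0, ∀ a b : X, nndist a b < D := by
    obtain ⟨D, hD⟩ := (Set.finite_range fun p : X × X => nndist p.1 p.2).bddAbove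
    exact ⟨D + 1, fun a b => lt_of_le_of_lt (hD ⟨(a, b), rfl⟩) (lt_add_one _)⟩
  obtain ⟨D, hD, hD0⟩ : ∃ D : ℝ≥0, (∀ a b : X, nndist a b < D) ∧ 0 < D :=
    ⟨D + 1, fun a b => (hD a b).trans (lt_add_one _), by positivity⟩
  obtain ⟨ε, hε0, hε, hX⟩ : ∃ ε : ℝ≥0, 0 < ε ∧ ε ≤ D ∧ ∀ a b : X, a ≠ b → ε ≤ nndist a b := by
    classical
    let T : Finset ℝ≥0 := insert D ((Finset.univ.filter fun p : X × X => p.1 ≠ p.2).image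
      fun p => nndist p.1 p.2)
    have hT : T.Nonempty := ⟨D, Finset.mem_insert_self _ _⟩
    refine ⟨T.min' hT, ?_, T.min'_le _ (Finset.mem_insert_self _ _), fun a b hab => ?_⟩
    · have := T.min'_mem hT
      rcases Finset.mem_insert.1 this with h | h
      · rw [h]; exact hD0
      · obtain ⟨p, hp, he⟩ := Finset.mem_image.1 h
        rw [← he]
        have : p.1 ≠ p.2 := (Finset.mem_filter.1 hp).2
        exact pos_iff_ne_zero.2 fun h => this (nndist_eq_zero.1 h)
    · exact T.min'_le _ (Finset.mem_insert_of_mem (Finset.mem_image.2 ⟨(a, b), by simpa using hab, rfl⟩))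
  have hS : ∀ k, Nonempty (Sys X n A f D ε k) := by
    intro k
    induction k with
    | zero => exact ⟨base hf hD hε hX⟩
    | succ k ih => exact ih.map fun S => step S hD hε
  obtain ⟨k, hk⟩ := exists_nat_gt (D / ε)
  have hk : D < k * ε := (div_lt_iff₀ hε0).1 hk
  obtain ⟨S⟩ := hS k
  letI : MetricSpace S.B := pathMetric S.self S.symm hε0 S.ge
  have hdist : ∀ x y : S.B,
      dist x y = ((⨅ l : List S.B, ((x::l).zipWith S.w (l ++ [y])).sum : ℝ≥0) : ℝ) := fun _ _ => rfl
  refine ⟨S.B, inferInstance, S.fin, S.ι, Isometry.of_dist_eq fun a b => ?_, fun i => ?_⟩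
  · rw [hdist, ← coe_nndist]
    congr 1
    apply le_antisymm
    · refine (ciInf_le (OrderBot.bddBelow _) []).trans_eq ?_
      simp [S.hι]
    · refine le_ciInf fun l => ?_
      obtain ⟨m, v, h1, h2, h3, h4⟩ := shrink S.self S.ge l (S.ι a) (S.ι b)
      rw [← h4]
      rcases le_total m k with h | h
      · have := S.P m h v (by rw [h1, h2, S.hι]; exact hD _ _)
        rwa [h1, h2, S.hι] at this
      · refine le_trans ?_ h3
        refine ((hD a b).trans hk).le.trans ?_
        gcongr
  · refine ⟨⟨S.ψ i, Isometry.of_dist_eq fun x y => ?_⟩, S.ext i⟩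
    rw [hdist, hdist]
    congr 1
    apply le_antisymm
    · exact iInf_map_le (S.hψ i) x y
    · have hg : ∀ x y, S.w ((S.ψ i).symm x) ((S.ψ i).symm y) = S.w x y := fun x y => by
        rw [← S.hψ i]; simp
      have := iInf_map_le hg (S.ψ i x) (S.ψ i y)
      simpa using this

end SoleckiAux

/-- Solecki's theorem: every finite metric space `X` with finitely many partial
isometries embeds isometrically into a finite metric space `Y` in which all these
partial isometries extend to bijective isometries. -/
theorem solecki_extension {X : Type*} [MetricSpace X] [Fintype X]
    (n : ℕ) (A : Fin n → Set X) (f : Fin n → X → X)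
    (hf : ∀ i, ∀ a ∈ A i, ∀ b ∈ A i, dist (f i a) (f i b) = dist a b) :
    ∃ (Y : Type) (_ : MetricSpace Y) (_ : Fintype Y) (ι : X → Y),
      Isometry ι ∧ ∀ i : Fin n, ∃ ψ : Y ≃ᵢ Y, ∀ a ∈ A i, ψ (ι a) = ι (f i a) := by
  obtain ⟨Y, _, hfin, ι, hι, h⟩ := SoleckiAux.core n A f hf
  let e : Y ≃ Shrink.{0} Y := equivShrink.{0} Y
  letI : MetricSpace (Shrink.{0} Y) := MetricSpace.induced e.symm e.symm.injective inferInstance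
  have he : ∀ x y, dist (e x) (e y) = dist x y := fun x y => by
    change dist (e.symm (e x)) (e.symm (e y)) = _
    simp
  let E : Y ≃ᵢ Shrink.{0} Y := ⟨e, Isometry.of_dist_eq he⟩
  haveI : Finite (Shrink.{0} Y) := Finite.of_equiv Y e
  refine ⟨Shrink.{0} Y, inferInstance, Fintype.ofFinite _, E ∘ ι, E.isometry.comp hι, fun i => ?_⟩
  obtain ⟨ψ, hψ⟩ := h i
  refine ⟨(E.symm.trans ψ).trans E, fun a ha => ?_⟩
  simp [hψ a ha]
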